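/- Let f : ℝ^n → ℝ be twice continuously differentiable and uniformly quasiconvex on ℝ^n with modulus φ, where φ(t) ≥ ρ t^q for some ρ > 0 and q ∈ (0,2] for all t in some neighborhood of 0. Suppose f has a global minimizer x* ∈ ℝ^n. Then f is locally strongly convex around x*: there exist a neighborhood U of x* and a constant μ > 0 such that for all x, y ∈ U, f(y) ≥ f(x) + ⟨∇f(x), y − x⟩ + (μ/2)‖y − x‖². -/

import Mathlib

noncomputable section

open Set
open scoped RealInnerProductSpace

/-- `φ : [0,∞) → [0,∞]` is a modulus: increasing and vanishing only at `0`. -/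
def IsModulus (φ : ℝ → EReal) : Prop :=
  (∀ ⦃s t : ℝ⦄, 0 ≤ s → s ≤ t → φ s ≤ φ t) ∧ φ 0 = 0 ∧ (∀ t : ℝ, 0 < t → 0 < φ t)

/-- `f` is uniformly quasiconvex on `C` with modulus `φ`. -/
def UnifQuasiconvexOn {E : Type*} [NormedAddCommGroup E] [NormedSpace ℝ E]
    (C : Set E) (φ : ℝ → EReal) (f : E → EReal) : Prop :=
  ∀ ⦃x⦄, x ∈ C → ∀ ⦃y⦄, y ∈ C → ∀ ⦃l : ℝ⦄, l ∈ Set.Icc (0 : ℝ) 1 →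
    f (l • x + (1 - l) • y) + ((l * (1 - l) : ℝ) : EReal) * φ ‖x - y‖ ≤ max (f x) (f y)

/-- A lower bound `a + b t` on the derivative integrates to a quadratic lower bound on `[0,1]`. -/
theorem add_half_le_of_affine_le_deriv {g g' : ℝ → ℝ} {a b : ℝ}
    (hg : ∀ t, HasDerivAt g (g' t) t) (hb : ∀ t ∈ Ioo (0 : ℝ) 1, a + b * t ≤ g' t) :
    g 0 + a + b / 2 ≤ g 1 := by
  have hd (t : ℝ) : HasDerivAt (fun t => g t - (a * t + b / 2 * t ^ 2)) (g' t - (a + b * t)) t := by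
    have h := (hg t).sub (((hasDerivAt_id t).const_mul a).add
      ((hasDerivAt_pow 2 t).const_mul (b / 2)))
    refine h.congr_deriv ?_
    norm_num
    ring
  have hmono : MonotoneOn (fun t => g t - (a * t + b / 2 * t ^ 2)) (Icc 0 1) := by
    refine monotoneOn_of_deriv_nonneg (convex_Icc 0 1)
      (fun t _ => (hd t).continuousAt.continuousWithinAt)
      (fun t _ => (hd t).differentiableAt.differentiableWithinAt) fun t ht => ?_
    rw [interior_Icc] at ht
    rw [(hd t).deriv]
    linarith [hb t ht]
  have h := hmono (left_mem_Icc.2 zero_le_one) (right_mem_Icc.2 zero_le_one) zero_le_one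
  norm_num at h
  linarith

/-- Second-order Taylor bound when the derivative of `f` is approximated by a linear map on a
convex set. -/
theorem abs_sub_taylor_two_le {E : Type*} [NormedAddCommGroup E] [NormedSpace ℝ E]
    {f : E → ℝ} (hf : Differentiable ℝ f) {H : E →L[ℝ] E →L[ℝ] ℝ} {s : Set E} {c : NNReal}
    (hs : Convex ℝ s) (hH : ApproximatesLinearOn (fderiv ℝ f) H s c) {x d : E}
    (hx : x ∈ s) (hxd : x + d ∈ s) :
    |f (x + d) - f x - fderiv ℝ f x d - H d d / 2| ≤ c / 2 * ‖d‖ ^ 2 := by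
  have hg (t : ℝ) : HasDerivAt (fun t : ℝ => f (x + t • d)) (fderiv ℝ f (x + t • d) d) t := by
    have hline : HasDerivAt (fun t : ℝ => x + t • d) d t := by
      simpa using ((hasDerivAt_id t).smul_const d).const_add x
    exact (hf (x + t • d)).hasFDerivAt.comp_hasDerivAt t hline
  have hbound (t : ℝ) (ht : t ∈ Ioo (0 : ℝ) 1) :
      |fderiv ℝ f (x + t • d) d - fderiv ℝ f x d - t * H d d| ≤ c * ‖d‖ ^ 2 * t := by
    have hmem : x + t • d ∈ s := hs.add_smul_mem hx hxd ⟨ht.1.le, ht.2.le⟩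
    have h := hH _ hmem _ hx
    rw [add_sub_cancel_left, norm_smul, Real.norm_of_nonneg ht.1.le] at h
    have h2 := ContinuousLinearMap.le_of_opNorm_le _ h d
    simp only [map_smul, sub_apply, smul_apply,
      smul_eq_mul, Real.norm_eq_abs] at h2
    exact h2.trans_eq (by ring)
  have hlow := add_half_le_of_affine_le_deriv (a := fderiv ℝ f x d)
    (b := H d d - c * ‖d‖ ^ 2) hg fun t ht => by linarith [(abs_le.1 (hbound t ht)).1]
  have hupp := add_half_le_of_affine_le_deriv (a := -fderiv ℝ f x d)
    (b := -(H d d + c * ‖d‖ ^ 2)) (fun t => (hg t).neg)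
    fun t ht => by linarith [(abs_le.1 (hbound t ht)).2]
  simp only [Pi.neg_apply, zero_smul, add_zero, one_smul] at hlow hupp
  rw [abs_le]
  constructor <;> linarith

/-- A uniformly quasiconvex function whose modulus dominates `ρ t ^ q` near `0` with `q ≤ 2` grows
at least quadratically around a global minimizer. -/
theorem UnifQuasiconvexOn.quadratic_growth {E : Type*} [NormedAddCommGroup E] [NormedSpace ℝ E]
    {φ : ℝ → EReal} {f : E → ℝ} (hquasi : UnifQuasiconvexOn univ φ fun x => ((f x : ℝ) : EReal))
    {ρ q ε : ℝ} (hρ : 0 < ρ) (hq0 : 0 < q) (hq2 : q ≤ 2)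
    (hlb : ∀ t : ℝ, 0 ≤ t → t < ε → ((ρ * t ^ q : ℝ) : EReal) ≤ φ t)
    {z : E} (hmin : ∀ x, f z ≤ f x) {d : E} (hdε : ‖d‖ < ε) (hd1 : ‖d‖ ≤ 1) :
    f z + ρ / 4 * ‖d‖ ^ 2 ≤ f (z + d) := by
  have hpow : ‖d‖ ^ 2 ≤ ‖d‖ ^ q := by
    rcases (norm_nonneg d).eq_or_lt with h | h
    · simp [← h, Real.zero_rpow hq0.ne']
    · simpa using Real.rpow_le_rpow_of_exponent_ge h hd1 hq2
  have h := hquasi (mem_univ (z + d)) (mem_univ z) (l := 1 / 2) (by norm_num)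
  rw [add_sub_cancel_left, max_eq_left (EReal.coe_le_coe_iff.2 (hmin _))] at h
  have hmul := mul_le_mul_of_nonneg_left (hlb ‖d‖ (norm_nonneg d) hdε)
    (EReal.coe_nonneg.2 (by norm_num : (0 : ℝ) ≤ 1 / 2 * (1 - 1 / 2)))
  have h2 := (add_le_add_right hmul _).trans h
  rw [← EReal.coe_mul, ← EReal.coe_add, EReal.coe_le_coe_iff] at h2
  have hmid := hmin ((1 / 2 : ℝ) • (z + d) + (1 - 1 / 2 : ℝ) • z)
  nlinarith

/-- **Local strong convexity.**  Let `f : ℝⁿ → ℝ` be `C²` and uniformly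
quasiconvex with modulus `φ`, where `φ(t) ≥ ρ t^q` (`ρ > 0`, `q ∈ (0,2]`) near `0`.  If
`x*` is a global minimizer of `f`, then `f` is locally strongly convex around `x*`. -/
theorem statement_5 (n : ℕ) (f : EuclideanSpace ℝ (Fin n) → ℝ)
    (hf : ContDiff ℝ 2 f)
    (φ : ℝ → EReal) (hφ : IsModulus φ)
    (hquasi : UnifQuasiconvexOn (Set.univ : Set (EuclideanSpace ℝ (Fin n))) φ
      (fun x => ((f x : ℝ) : EReal)))
    (ρ q : ℝ) (hρ : 0 < ρ) (hq0 : 0 < q) (hq2 : q ≤ 2)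
    (hlb : ∃ ε > (0 : ℝ), ∀ t : ℝ, 0 ≤ t → t < ε → ((ρ * t ^ q : ℝ) : EReal) ≤ φ t)
    (xstar : EuclideanSpace ℝ (Fin n)) (hmin : ∀ x, f xstar ≤ f x) :
    ∃ U ∈ nhds xstar, ∃ μ : ℝ, 0 < μ ∧
      ∀ x ∈ U, ∀ y ∈ U,
        f x + ⟪gradient f x, y - x⟫ + μ / 2 * ‖y - x‖ ^ 2 ≤ f y := by
  obtain ⟨ε, hε, hlb⟩ := hlb
  have hdiff : Differentiable ℝ f := hf.differentiable two_ne_zero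
  have hstrict := (hf.fderiv_right (m := 1) (by norm_num)).contDiffAt.hasStrictFDerivAt
    (x := xstar) one_ne_zero
  set H := fderiv ℝ (fderiv ℝ f) xstar
  let c : NNReal := ⟨ρ / 8, by positivity⟩
  have hc : (c : ℝ) = ρ / 8 := rfl
  obtain ⟨s, hs, hsH⟩ := hstrict.approximates_deriv_on_nhds (c := c)
    (Or.inr (by rw [← NNReal.coe_pos, hc]; positivity))
  obtain ⟨r, hr, hrs⟩ := Metric.mem_nhds_iff.1 hs
  have happrox := hsH.mono_set hrs
  have htaylor {x d : EuclideanSpace ℝ (Fin n)} := abs_sub_taylor_two_le (x := x) (d := d) hdiff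
    (convex_ball xstar r) happrox
  have hcrit : fderiv ℝ f xstar = 0 :=
    IsLocalMin.fderiv_eq_zero (Filter.Eventually.of_forall hmin)
  have hpos (d : EuclideanSpace ℝ (Fin n)) (hdr : ‖d‖ < r) (hdε : ‖d‖ < ε) (hd1 : ‖d‖ ≤ 1) :
      3 * ρ / 8 * ‖d‖ ^ 2 ≤ H d d := by
    have h := htaylor (x := xstar) (d := d) (Metric.mem_ball_self hr) (by simpa using hdr)
    have hgrow := hquasi.quadratic_growth hρ hq0 hq2 hlb hmin hdε hd1
    rw [hcrit, hc, zero_apply] at h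
    linarith [(abs_le.1 h).2]
  obtain ⟨δ, hδ, hδm⟩ := exists_between (lt_min hr (lt_min hε one_pos))
  simp only [lt_min_iff] at hδm
  refine ⟨Metric.ball xstar (δ / 2), Metric.ball_mem_nhds _ (half_pos hδ), ρ / 4, by positivity,
    fun x hx y hy => ?_⟩
  have hyx : ‖y - x‖ < δ := by
    rw [← dist_eq_norm]
    linarith [dist_triangle_right y x xstar, Metric.mem_ball.1 hx, Metric.mem_ball.1 hy]
  have hsub : Metric.ball xstar (δ / 2) ⊆ Metric.ball xstar r :=
    Metric.ball_subset_ball (by linarith)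
  have h := htaylor (x := x) (d := y - x) (hsub hx) (by simpa using hsub hy)
  have hp := hpos (y - x) (by linarith) (by linarith) (by linarith)
  rw [add_sub_cancel, hc] at h
  rw [gradient, InnerProductSpace.toDual_symm_apply]
  linarith [(abs_le.1 h).1]
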